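/- Let T be a Y(2|1) T-family in A, let M be a left A-module with highest weight vector Ω, let a ≥ 1, b ≥ 0, and let ū = (u₁,…,u_a), v̄ = (v₁,…,v_b) have admissible concatenation. Define the Bethe vector Φ_{a,b}(ū,v̄) = Σ g(v̄_I,ū_I)·f(ū_I,ū_II)·g(v̄_II,v̄_I)·h(ū_I,ū_I)·λ₂(v̄_I)·𝕋₁₃(ū_I)·T₁₂(ū_II)·𝕋₂₃(v̄_II)·Ω (sum over all partitions ū = ū_I ⊔ ū_II, v̄ = v̄_I ⊔ v̄_II with #ū_I = #v̄_I). Then Φ_{a,b}(ū,v̄) = T₁₂(u₁)·Φ_{a−1,b}(ū₁,v̄) + Σ_{j=1}^{b} λ₂(vⱼ)·g(vⱼ,u₁)·f(vⱼ,ū₁)·g(v̄ⱼ,vⱼ)·T₁₃(u₁)·Φ_{a−1,b−1}(ū₁,v̄ⱼ), where ū₁ = ū with u₁ removed and v̄ⱼ = v̄ with vⱼ removed. -/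

import Mathlib

open scoped BigOperators
open MulOpposite

noncomputable section

namespace Bethe

variable {A : Type*} [Ring A] [Algebra ℂ A]

/-- `g(u,v) = c/(u-v)` -/
def gg (c u v : ℂ) : ℂ := c / (u - v)

/-- `f(u,v) = (u-v+c)/(u-v)` -/
def ff (c u v : ℂ) : ℂ := (u - v + c) / (u - v)

/-- `h(u,v) = (u-v+c)/c` -/
def hh (c u v : ℂ) : ℂ := (u - v + c) / c

/-- A list of parameters is admissible if its entries are pairwise distinct and
`x - y + c ≠ 0` for any two distinct entries `x`, `y`. -/
def Admissible (c : ℂ) (l : List ℂ) : Prop :=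
  l.Pairwise fun x y => x ≠ y ∧ x - y + c ≠ 0 ∧ y - x + c ≠ 0

/-- `∏_{x ∈ xs} ∏_{y ∈ ys} f(x,y)` -/
def prodFF (c : ℂ) (xs ys : List ℂ) : ℂ :=
  (xs.map fun x => (ys.map fun y => ff c x y).prod).prod

/-- `∏_{x ∈ xs} ∏_{y ∈ ys} g(x,y)` -/
def prodGG (c : ℂ) (xs ys : List ℂ) : ℂ :=
  (xs.map fun x => (ys.map fun y => gg c x y).prod).prod

/-- `∏_{x ∈ xs} ∏_{y ∈ ys} h(x,y)` -/
def prodHH (c : ℂ) (xs ys : List ℂ) : ℂ :=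
  (xs.map fun x => (ys.map fun y => hh c x y).prod).prod

/-- `H(w̄) = ∏_{j>k} h(wⱼ,wₖ)` -/
def Hnorm (c : ℂ) : List ℂ → ℂ
  | [] => 1
  | x :: xs => ((xs.map fun y => hh c y x).prod) * Hnorm c xs

/-- `H(w̄*) = ∏_{j<k} h(wⱼ,wₖ)` -/
def HnormRev (c : ℂ) : List ℂ → ℂ
  | [] => 1
  | x :: xs => ((xs.map fun y => hh c x y).prod) * HnormRev c xs

/-- product of `h` over ordered pairs of distinct positions of a list -/
def prodHHne (c : ℂ) (xs : List ℂ) : ℂ :=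
  ∏ j : Fin xs.length, ∏ k : Fin xs.length,
    if j ≠ k then hh c (xs.get j) (xs.get k) else 1

/-- ordered product `T(w₁)⋯T(wₙ)` -/
def Tprod (Tij : ℂ → A) (l : List ℂ) : A := (l.map Tij).prod

/-- normalized ordered product `H(w̄)⁻¹ T(w₁)⋯T(wₙ)` -/
def TT (c : ℂ) (Tij : ℂ → A) (l : List ℂ) : A := (Hnorm c l)⁻¹ • Tprod Tij l

/-- normalized ordered product `H(w̄*)⁻¹ T(w₁)⋯T(wₙ)` -/
def TTrev (c : ℂ) (Tij : ℂ → A) (l : List ℂ) : A := (HnormRev c l)⁻¹ • Tprod Tij l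

/-- The defining (RTT) commutation relations of a super-Yangian `T`-family with
`ℤ₂`-grading `p`. -/
def IsTFam (c : ℂ) {N : ℕ} (p : Fin N → ℕ) (T : Fin N → Fin N → ℂ → A) : Prop :=
  ∀ i j k l : Fin N, ∀ z w : ℂ, z ≠ w →
    T i j z * T k l w - ((-1 : ℂ) ^ ((p i + p j) * (p k + p l))) • (T k l w * T i j z)
      = ((-1 : ℂ) ^ (p l * (p i + p j) + p i * p j) * gg c z w) •
          (T i l z * T k j w - T i l w * T k j z)

/-- the distinguished grading of `gl(2|1)`: `[1]=[2]=0`, `[3]=1` -/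
def p21 : Fin 3 → ℕ := ![0, 0, 1]

/-- the distinguished grading of `gl(1|2)`: `[1]=0`, `[2]=[3]=1` -/
def p12 : Fin 3 → ℕ := ![0, 1, 1]

/-- the sublist of `l` given by the positions in `S`, in the inherited order -/
def sel (l : List ℂ) (S : Finset (Fin l.length)) : List ℂ :=
  (S.sort (· ≤ ·)).map l.get

/-- `λ(w̄) = ∏ⱼ λ(wⱼ)` -/
def lamP (lam2 : ℂ → ℂ) (l : List ℂ) : ℂ := (l.map lam2).prod

/-- The Izergin kernel `K_ℓ(v̄|ū)`. -/
def Kiz (c : ℂ) {ℓ : ℕ} (vs us : Fin ℓ → ℂ) : ℂ :=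
  (∏ j : Fin ℓ, ∏ k : Fin ℓ, if (k : ℕ) < (j : ℕ) then gg c (vs j) (vs k) else 1) *
    (∏ j : Fin ℓ, ∏ k : Fin ℓ, if (k : ℕ) < (j : ℕ) then gg c (us k) (us j) else 1) *
    (∏ j : Fin ℓ, ∏ k : Fin ℓ, hh c (vs j) (us k)) *
    Matrix.det (Matrix.of fun j k => gg c (vs j) (us k) / hh c (vs j) (us k))

/-- The Izergin kernel for lists of equal length (and junk value `0` otherwise). -/
def KizL (c : ℂ) (vs us : List ℂ) : ℂ :=
  if h : vs.length = us.length then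
    Kiz c vs.get fun j => us.get (Fin.cast h j)
  else 0

/-- The operator `X_{a,b}(ū,v̄)` of the paper (`Y(2|1)` case). -/
def X (c : ℂ) (T : Fin 3 → Fin 3 → ℂ → A) (u v : List ℂ) : A :=
  ∑ S : Finset (Fin u.length), ∑ Q : Finset (Fin v.length),
    if S.card = Q.card then
      (prodGG c (sel v Q) (sel u S) * prodFF c (sel u S) (sel u Sᶜ) *
          prodGG c (sel v Qᶜ) (sel v Q) * prodHHne c (sel u S)) •
        (TT c (T 0 2) (sel u S) * Tprod (T 0 1) (sel u Sᶜ) *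
          TT c (T 1 2) (sel v Qᶜ) * Tprod (T 1 1) (sel v Q))
    else 0

/-- The operator `Y_{a,b}(ū,v̄)` of the paper (`Y(2|1)` case). -/
def Y (c : ℂ) (T : Fin 3 → Fin 3 → ℂ → A) (u v : List ℂ) : A :=
  ∑ S : Finset (Fin u.length), ∑ Q : Finset (Fin v.length),
    if S.card = Q.card then
      (KizL c (sel v Q) (sel u S) * prodFF c (sel u S) (sel u Sᶜ) *
          prodGG c (sel v Qᶜ) (sel v Q)) •
        (TT c (T 0 2) (sel v Q) * TT c (T 1 2) (sel v Qᶜ) *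
          Tprod (T 0 1) (sel u Sᶜ) * Tprod (T 1 1) (sel u S))
    else 0

/-- First explicit expression for the `Y(2|1)` Bethe vector (operator part,
the weights `λ₂` included as scalars). -/
def PhiA (c : ℂ) (T : Fin 3 → Fin 3 → ℂ → A) (lam2 : ℂ → ℂ) (u v : List ℂ) : A :=
  ∑ S : Finset (Fin u.length), ∑ Q : Finset (Fin v.length),
    if S.card = Q.card then
      (prodGG c (sel v Q) (sel u S) * prodFF c (sel u S) (sel u Sᶜ) *
          prodGG c (sel v Qᶜ) (sel v Q) * prodHHne c (sel u S) * lamP lam2 (sel v Q)) •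
        (TT c (T 0 2) (sel u S) * Tprod (T 0 1) (sel u Sᶜ) * TT c (T 1 2) (sel v Qᶜ))
    else 0

/-- Second explicit expression for the `Y(2|1)` Bethe vector (operator part). -/
def PhiB (c : ℂ) (T : Fin 3 → Fin 3 → ℂ → A) (lam2 : ℂ → ℂ) (u v : List ℂ) : A :=
  ∑ S : Finset (Fin u.length), ∑ Q : Finset (Fin v.length),
    if S.card = Q.card then
      (KizL c (sel v Q) (sel u S) * prodFF c (sel u S) (sel u Sᶜ) *
          prodGG c (sel v Qᶜ) (sel v Q) * lamP lam2 (sel u S)) •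
        (TT c (T 0 2) (sel v Q) * TT c (T 1 2) (sel v Qᶜ) * Tprod (T 0 1) (sel u Sᶜ))
    else 0

/-- First explicit expression for the `Y(1|2)` Bethe vector, without the overall
sign `(-1)^b` (operator part). -/
def PhiTA (c : ℂ) (T : Fin 3 → Fin 3 → ℂ → A) (lam2 : ℂ → ℂ) (u v : List ℂ) : A :=
  ∑ S : Finset (Fin u.length), ∑ Q : Finset (Fin v.length),
    if S.card = Q.card then
      (prodGG c (sel u S) (sel v Q) * prodFF c (sel v Q) (sel v Qᶜ) *
          prodGG c (sel u Sᶜ) (sel u S) * prodHHne c (sel v Q) * lamP lam2 (sel u S)) •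
        (TT c (T 0 2) (sel v Q) * Tprod (T 1 2) (sel v Qᶜ) * TT c (T 0 1) (sel u Sᶜ))
    else 0

/-- Second explicit expression for the `Y(1|2)` Bethe vector, without the overall
sign `(-1)^b` (operator part). -/
def PhiTB (c : ℂ) (T : Fin 3 → Fin 3 → ℂ → A) (lam2 : ℂ → ℂ) (u v : List ℂ) : A :=
  ∑ S : Finset (Fin u.length), ∑ Q : Finset (Fin v.length),
    if S.card = Q.card then
      (KizL c (sel u S) (sel v Q) * prodFF c (sel v Q) (sel v Qᶜ) *
          prodGG c (sel u Sᶜ) (sel u S) * lamP lam2 (sel v Q)) •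
        (TT c (T 0 2) (sel u S) * TT c (T 0 1) (sel u Sᶜ) * Tprod (T 1 2) (sel v Qᶜ))
    else 0

/-- First explicit expression for the dual `Y(2|1)` Bethe vector, without the
overall sign `(-1)^{b(b-1)/2}`.  `E` is a right `A`-module, i.e. a left
`Aᵐᵒᵖ`-module; `op X • Ωd` is `Ωd · X`. -/
def PsiA {E : Type*} [AddCommGroup E] [Module ℂ E] [Module Aᵐᵒᵖ E]
    (c : ℂ) (T : Fin 3 → Fin 3 → ℂ → A) (lam2 : ℂ → ℂ) (u v : List ℂ) (Ωd : E) : E :=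
  ∑ S : Finset (Fin u.length), ∑ Q : Finset (Fin v.length),
    if S.card = Q.card then
      (prodGG c (sel v Q) (sel u S) * prodFF c (sel u S) (sel u Sᶜ) *
          prodGG c (sel v Qᶜ) (sel v Q) * prodHHne c (sel u S) * lamP lam2 (sel v Q)) •
        (op (TTrev c (T 2 1) (sel v Qᶜ) * Tprod (T 1 0) (sel u Sᶜ) *
              TTrev c (T 2 0) (sel u S)) • Ωd)
    else 0

/-- The dual `Y(2|1)` Bethe vector `Ψ_{a,b}(ū,v̄)`. -/
def Psi {E : Type*} [AddCommGroup E] [Module ℂ E] [Module Aᵐᵒᵖ E]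
    (c : ℂ) (T : Fin 3 → Fin 3 → ℂ → A) (lam2 : ℂ → ℂ) (u v : List ℂ) (Ωd : E) : E :=
  ((-1 : ℂ) ^ (v.length * (v.length - 1) / 2)) • PsiA c T lam2 u v Ωd

/-- Second explicit expression for the dual `Y(2|1)` Bethe vector, without the
overall sign `(-1)^{b(b-1)/2}`. -/
def PsiB {E : Type*} [AddCommGroup E] [Module ℂ E] [Module Aᵐᵒᵖ E]
    (c : ℂ) (T : Fin 3 → Fin 3 → ℂ → A) (lam2 : ℂ → ℂ) (u v : List ℂ) (Ωd : E) : E :=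
  ∑ S : Finset (Fin u.length), ∑ Q : Finset (Fin v.length),
    if S.card = Q.card then
      (KizL c (sel v Q) (sel u S) * prodFF c (sel u S) (sel u Sᶜ) *
          prodGG c (sel v Qᶜ) (sel v Q) * lamP lam2 (sel u S)) •
        (op (Tprod (T 1 0) (sel u Sᶜ) * TTrev c (T 2 1) (sel v Qᶜ) *
              TTrev c (T 2 0) (sel v Q)) • Ωd)
    else 0

/-- pairwise good finite set of parameters -/
def Good (c : ℂ) (s : Finset ℂ) : Prop :=
  ∀ x ∈ s, ∀ y ∈ s, x ≠ y → x - y + c ≠ 0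

theorem Good.mono {c : ℂ} {s t : Finset ℂ} (h : Good c t) (hst : s ⊆ t) : Good c s :=
  fun x hx y hy hxy => h x (hst hx) y (hst hy) hxy

theorem TT_cons (c : ℂ) (T : ℂ → A) (x : ℂ) (l : List ℂ) :
    TT c T (x :: l) = ((l.map fun y => hh c y x).prod)⁻¹ • (T x * TT c T l) := by
  simp [TT, Tprod, Hnorm, smul_smul, mul_comm]

theorem Admissible.perm {c : ℂ} {l l' : List ℂ} (h : l.Perm l') (ha : Admissible c l) :
    Admissible c l' :=
  h.pairwise ha (fun {_ _} h => ⟨h.1.symm, h.2.2, h.2.1⟩)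

/-- the swap property of an odd generator -/
def Swap (c : ℂ) (T : ℂ → A) : Prop :=
  ∀ z w : ℂ, z ≠ w → hh c z w • (T z * T w) = hh c w z • (T w * T z)

theorem TT_perm {c : ℂ} (hc : c ≠ 0) {T : ℂ → A} (hT : Swap c T) {l l' : List ℂ}
    (h : l.Perm l') (ha : Admissible c l) : TT c T l = TT c T l' := by
  induction h with
  | nil => rfl
  | @cons x l₁ l₂ hp ih =>
    rw [TT_cons, TT_cons, ih (List.pairwise_cons.1 ha).2, (hp.map _).prod_eq]
  | swap x y l =>
    simp only [TT_cons, List.map_cons, List.prod_cons]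
    have h1 := (List.pairwise_cons.1 ha).1 x (by simp)
    have e := hT y x h1.1
    have n1 : hh c y x ≠ 0 := div_ne_zero h1.2.1 hc
    have n2 : hh c x y ≠ 0 := div_ne_zero h1.2.2 hc
    simp only [mul_smul_comm, smul_smul, ← mul_assoc]
    have e2 : T y * T x = ((hh c y x)⁻¹ * hh c x y) • (T x * T y) := by
      rw [mul_smul, ← e, smul_smul, inv_mul_cancel₀ n1, one_smul]
    rw [e2, smul_mul_assoc, smul_smul]
    congr 1
    simp only [mul_inv]
    field_simp
  | trans h1 h2 ih1 ih2 => exact (ih1 ha).trans (ih2 (ha.perm h1))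

theorem Good.admissible {c : ℂ} {s : Finset ℂ} (h : Good c s) : Admissible c s.toList := by
  have := s.nodup_toList
  refine List.Pairwise.imp_of_mem ?_ this
  intro x y hx hy hxy
  rw [Finset.mem_toList] at hx hy
  exact ⟨hxy, h x hx y hy hxy, h y hy x hx hxy.symm⟩

theorem Admissible.good {c : ℂ} {l : List ℂ} (h : Admissible c l) : Good c l.toFinset := by
  intro x hx y hy hxy
  rw [List.mem_toFinset] at hx hy
  have hs : Std.Symm (fun x y : ℂ => x ≠ y → (x - y + c ≠ 0 ∧ y - x + c ≠ 0)) :=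
    ⟨fun _ _ h1 h2 => (h1 h2.symm).symm⟩
  have := List.Pairwise.forall_of_forall (R := fun x y => x ≠ y → (x - y + c ≠ 0 ∧ y - x + c ≠ 0))
    (l := l) (fun _ _ h => absurd rfl h) (h.imp fun h _ => h.2)
  exact (this hx hy hxy).1

/-- normalized product over a finite set -/
def DD (c : ℂ) (T : ℂ → A) (s : Finset ℂ) : A := TT c T s.toList

/-- product over a finite set -/
def BB (T : ℂ → A) (s : Finset ℂ) : A := Tprod T s.toList

theorem DD_insert {c : ℂ} (hc : c ≠ 0) {T : ℂ → A} (hT : Swap c T) {a : ℂ} {r : Finset ℂ}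
    (ha : a ∉ r) (hg : Good c (insert a r)) :
    T a * DD c T r = (∏ y ∈ r, hh c y a) • DD c T (insert a r) := by
  have hp : (insert a r).toList.Perm (a :: r.toList) := Finset.toList_insert ha
  have hn : (∏ y ∈ r, hh c y a) ≠ 0 := by
    rw [Finset.prod_ne_zero_iff]
    intro y hy
    refine div_ne_zero (hg y (by simp [hy]) a (by simp) ?_) hc
    rintro rfl; exact ha hy
  rw [DD, DD, TT_perm hc hT hp hg.admissible, TT_cons, Finset.prod_map_toList, smul_smul,
    mul_inv_cancel₀ hn, one_smul]

theorem Tprod_perm {c : ℂ} {T : ℂ → A}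
    (hT : ∀ z w : ℂ, z ≠ w → z - w + c ≠ 0 → w - z + c ≠ 0 → T z * T w = T w * T z)
    {l l' : List ℂ}
    (h : l.Perm l') (ha : Admissible c l) : Tprod T l = Tprod T l' := by
  refine (h.map T).prod_eq' ?_
  rw [List.pairwise_map]
  exact ha.imp fun h => hT _ _ h.1 h.2.1 h.2.2

theorem BB_insert {c : ℂ} {T : ℂ → A}
    (hT : ∀ z w : ℂ, z ≠ w → z - w + c ≠ 0 → w - z + c ≠ 0 → T z * T w = T w * T z)
    {a : ℂ} {r : Finset ℂ}
    (ha : a ∉ r) (hg : Good c (insert a r)) :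
    T a * BB T r = BB T (insert a r) := by
  have hp : (insert a r).toList.Perm (a :: r.toList) := Finset.toList_insert ha
  rw [BB, BB, Tprod_perm hT hp hg.admissible]
  simp [Tprod]

section rel
variable {c : ℂ} {T : Fin 3 → Fin 3 → ℂ → A}

theorem rel_swap (hc : c ≠ 0) (hT : IsTFam c p21 T) (i : Fin 3) (hi : p21 i = 0) :
    Swap c (T i 2) := by
  intro z w hzw
  have h := hT i 2 i 2 z w hzw
  have h2 : p21 2 = 1 := rfl
  rw [hi, h2] at h
  norm_num at h
  have hz : z - w ≠ 0 := sub_ne_zero.2 hzw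
  set P := T i 2 z * T i 2 w
  set R := T i 2 w * T i 2 z
  have h3 : (1 + gg c z w) • P = (gg c z w - 1) • R := by
    have : P = -(gg c z w • (P - R)) - R := by rw [← h]; abel
    rw [add_smul, one_smul, sub_smul, one_smul]
    nth_rewrite 1 [this]
    rw [smul_sub]; abel
  have e1 : hh c z w = ((z - w) / c) * (1 + gg c z w) := by
    simp only [hh, gg]; field_simp
  have e2 : hh c w z = ((z - w) / c) * (gg c z w - 1) := by
    simp only [hh, gg]; field_simp; ring
  rw [e1, e2, mul_smul, mul_smul, h3]

theorem rel_comm (hT : IsTFam c p21 T) :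
    ∀ z w : ℂ, z ≠ w → z - w + c ≠ 0 → w - z + c ≠ 0 →
      T 0 1 z * T 0 1 w = T 0 1 w * T 0 1 z := by
  intro z w hzw _ hb
  have h := hT 0 1 0 1 z w hzw
  have h1 : p21 0 = 0 := rfl
  have h2 : p21 1 = 0 := rfl
  rw [h1, h2] at h
  norm_num at h
  have hz : z - w ≠ 0 := sub_ne_zero.2 hzw
  have h3 : (1 - gg c z w) • (T 0 1 z * T 0 1 w - T 0 1 w * T 0 1 z) = 0 := by
    rw [sub_smul, one_smul, ← h, sub_self]
  rcases smul_eq_zero.1 h3 with h4 | h4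
  · exfalso
    apply hb
    simp only [gg] at h4
    field_simp at h4
    linear_combination -h4
  · exact sub_eq_zero.1 h4

theorem rel_12_13 (hT : IsTFam c p21 T) (z w : ℂ) (hzw : z ≠ w) :
    T 0 1 z * T 0 2 w = ff c w z • (T 0 2 w * T 0 1 z) + gg c z w • (T 0 2 z * T 0 1 w) := by
  have h := hT 0 1 0 2 z w hzw
  have h1 : p21 0 = 0 := rfl
  have h2 : p21 1 = 0 := rfl
  have h3 : p21 2 = 1 := rfl
  rw [h1, h2, h3] at h
  norm_num at h
  have hz : z - w ≠ 0 := sub_ne_zero.2 hzw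
  have hz' : w - z ≠ 0 := sub_ne_zero.2 hzw.symm
  have e : ff c w z = 1 - gg c z w := by
    simp only [ff, gg]; rw [← neg_sub w z]; field_simp; ring
  rw [e, sub_smul, one_smul, sub_eq_iff_eq_add.1 h, smul_sub]
  abel

end rel

/-- product over ordered pairs of distinct elements -/
def Hne (c : ℂ) (s : Finset ℂ) : ℂ := ∏ x ∈ s, ∏ y ∈ s.erase x, hh c x y

theorem Hne_insert (c : ℂ) {a : ℂ} {s : Finset ℂ} (ha : a ∉ s) :
    Hne c (insert a s) = (∏ y ∈ s, hh c a y) * (∏ y ∈ s, hh c y a) * Hne c s := by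
  unfold Hne
  rw [Finset.prod_insert ha, Finset.erase_insert ha, mul_assoc,
    ← Finset.prod_mul_distrib (s := s) (f := fun y => hh c y a)]
  congr 1
  refine Finset.prod_congr rfl fun x hx => ?_
  have hxa : a ≠ x := by rintro rfl; exact ha hx
  rw [Finset.erase_insert_of_ne hxa, Finset.prod_insert (by simp [ha])]

theorem op_lemma {c : ℂ} (hc : c ≠ 0) {T : Fin 3 → Fin 3 → ℂ → A} (hT : IsTFam c p21 T)
    (w : Finset ℂ) : ∀ z : ℂ, z ∉ w → Good c (insert z w) →
    T 0 1 z * DD c (T 0 2) w = (∏ y ∈ w, ff c y z) • (DD c (T 0 2) w * T 0 1 z) +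
      ∑ k ∈ w, (gg c z k * (∏ y ∈ w.erase k, gg c y k) * ∏ y ∈ w.erase k, hh c y z) •
        (DD c (T 0 2) (insert z (w.erase k)) * T 0 1 k) := by
  have hS := rel_swap hc hT 0 rfl
  induction w using Finset.induction_on with
  | empty => intro z _ _; simp [DD, TT, Tprod, Hnorm]
  | @insert a w ha ih =>
    intro z hz hg
    have hza : z ≠ a := by rintro rfl; simp at hz
    have hzw : z ∉ w := fun h => hz (by simp [h])
    have hgz : Good c (insert z w) := hg.mono (by intro x; simp; tauto)
    have hga : Good c (insert a w) := hg.mono (by intro x; simp; tauto)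
    have hn : (∏ y ∈ w, hh c y a) ≠ 0 := by
      rw [Finset.prod_ne_zero_iff]
      intro y hy
      refine div_ne_zero (hga y (by simp [hy]) a (by simp) ?_) hc
      rintro rfl; exact ha hy
    have hD := DD_insert hc hS ha hga
    refine smul_right_injective A hn ?_
    simp only
    rw [← mul_smul_comm, ← hD, ← mul_assoc, rel_12_13 hT z a hza, add_mul, smul_mul_assoc,
      smul_mul_assoc, mul_assoc, mul_assoc, ih z hzw hgz, ih a ha hga]
    rw [smul_add, Finset.prod_insert ha, Finset.sum_insert ha, Finset.erase_insert ha]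
    simp only [mul_add, smul_add, Finset.mul_sum, Finset.smul_sum, mul_smul_comm, ← mul_assoc]
    rw [hD, DD_insert hc hS hzw hgz]
    have key : ∀ k ∈ w,
        ff c a z • (gg c z k * (∏ y ∈ w.erase k, gg c y k) * ∏ y ∈ w.erase k, hh c y z) •
          (T 0 2 a * DD c (T 0 2) (insert z (w.erase k)) * T 0 1 k) +
        gg c z a • (gg c a k * (∏ y ∈ w.erase k, gg c y k) * ∏ y ∈ w.erase k, hh c y a) •
          (T 0 2 z * DD c (T 0 2) (insert a (w.erase k)) * T 0 1 k) =
        (∏ y ∈ w, hh c y a) • (gg c z k * (∏ y ∈ (insert a w).erase k, gg c y k) *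
          ∏ y ∈ (insert a w).erase k, hh c y z) •
          (DD c (T 0 2) (insert z ((insert a w).erase k)) * T 0 1 k) := by
      intro k hk
      have hka : k ≠ a := by rintro rfl; exact ha hk
      have hkz : k ≠ z := by rintro rfl; exact hzw hk
      have hak : a ∉ w.erase k := by simp [ha]
      have hzk : z ∉ w.erase k := by simp [hzw]
      have s1 : insert a (insert z (w.erase k)) ⊆ insert z (insert a w) := by
        intro x; simp; tauto
      have s2 : insert z (insert a (w.erase k)) ⊆ insert z (insert a w) := by
        intro x; simp; tauto
      rw [DD_insert hc hS (by simp [ha, hza.symm]) (hg.mono s1),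
        DD_insert hc hS (by simp [hzw, hza]) (hg.mono s2),
        Finset.insert_comm a z, Finset.erase_insert_of_ne hka.symm, Finset.prod_insert hzk,
        Finset.prod_insert hak, Finset.prod_insert hak, ← Finset.mul_prod_erase w _ hk]
      simp only [smul_mul_assoc, smul_smul, ← add_smul]
      congr 1
      have d1 : z - a ≠ 0 := sub_ne_zero.2 hza
      have d1' : a - z ≠ 0 := sub_ne_zero.2 hza.symm
      have d2 : z - k ≠ 0 := sub_ne_zero.2 hkz.symm
      have d3 : a - k ≠ 0 := sub_ne_zero.2 hka.symm
      have e : ff c a z * gg c z k * hh c z a + gg c z a * gg c a k * hh c a z =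
          hh c k a * gg c z k * gg c a k * hh c a z := by
        simp only [ff, gg, hh]
        rw [← neg_sub z a] at *
        field_simp
        ring
      linear_combination (∏ y ∈ w.erase k, gg c y k) * (∏ y ∈ w.erase k, hh c y z) *
        (∏ y ∈ w.erase k, hh c y a) * e
    rw [← Finset.sum_congr rfl key, Finset.sum_add_distrib]
    have e1 : (ff c a z • (∏ x ∈ w, ff c x z) • ((∏ y ∈ w, hh c y a) • DD c (T 0 2) (insert a w) * T 0 1 z))
       = (∏ y ∈ w, hh c y a) • (ff c a z * ∏ x ∈ w, ff c x z) • (DD c (T 0 2) (insert a w) * T 0 1 z) := by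
      simp only [smul_mul_assoc, smul_smul]; congr 1; ring
    have e2 : (gg c z a • (∏ x ∈ w, ff c x a) • ((∏ y ∈ w, hh c y z) • DD c (T 0 2) (insert z w) * T 0 1 a))
       = (∏ y ∈ w, hh c y a) • (gg c z a * (∏ x ∈ w, gg c x a) * ∏ x ∈ w, hh c x z) •
          (DD c (T 0 2) (insert z w) * T 0 1 a) := by
      have : ∏ x ∈ w, ff c x a = (∏ x ∈ w, gg c x a) * ∏ x ∈ w, hh c x a := by
        rw [← Finset.prod_mul_distrib]
        refine Finset.prod_congr rfl fun x hx => ?_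
        simp only [ff, gg, hh]; field_simp
      rw [this]
      simp only [smul_mul_assoc, smul_smul]; congr 1; ring
    rw [e1, e2]
    abel

theorem partial_frac {c : ℂ} (hc : c ≠ 0) (z : ℂ) (V X Y : Finset ℂ) (hVY : Disjoint V Y)
    (hzV : z ∉ V) (hzY : z ∉ Y) (hcard : V.card = X.card + 1) :
    (∏ v ∈ V, gg c v z) * (∏ y ∈ Y, ff c z y) * (∏ x ∈ X, hh c z x) =
      ∑ k ∈ Y, (∏ v ∈ V, gg c v k) * (∏ y ∈ Y.erase k, ff c k y) * (∏ x ∈ X, hh c k x) *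
          gg c z k +
      ∑ j ∈ V, gg c j z * (∏ x ∈ X, hh c j x) * (∏ y ∈ Y, ff c j y) *
          ∏ v ∈ V.erase j, gg c v j := by
  classical
  set N : Polynomial ℂ := (∏ y ∈ Y, (Polynomial.X + Polynomial.C (c - y))) *
    ∏ x ∈ X, (Polynomial.X + Polynomial.C (c - x)) with hN
  have hNe : ∀ t, N.eval t = (∏ y ∈ Y, (t - y + c)) * ∏ x ∈ X, (t - x + c) := by
    intro t
    rw [hN, Polynomial.eval_mul, Polynomial.eval_prod, Polynomial.eval_prod]
    congr 1 <;> refine Finset.prod_congr rfl fun _ _ => ?_ <;> simp <;> ring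
  have hNd : N.degree < ((V ∪ Y).card : ℕ) := by
    rw [Finset.card_union_of_disjoint hVY, hcard, hN, Polynomial.degree_mul,
      Polynomial.degree_prod, Polynomial.degree_prod]
    simp only [Polynomial.degree_X_add_C, Finset.sum_const, nsmul_eq_mul, mul_one]
    norm_cast
    omega
  have hz : ∀ i ∈ V ∪ Y, z ≠ id i := by
    rintro i hi rfl
    simp at hi; tauto
  have key := Lagrange.eq_interpolate (s := V ∪ Y) (v := id) (f := N)
    (fun _ _ _ _ h => h) hNd
  have key2 := congrArg (Polynomial.eval z) key
  rw [Lagrange.eval_interpolate_not_at_node _ hz, Lagrange.eval_nodal,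
    Finset.sum_union hVY, Finset.prod_union hVY] at key2
  have hsV : ∀ j ∈ V, (V ∪ Y).erase j = V.erase j ∪ Y := by
    intro j hj
    have := Finset.disjoint_left.1 hVY hj
    ext x; simp only [Finset.mem_erase, Finset.mem_union]
    constructor
    · tauto
    · rintro (h | h)
      · tauto
      · exact ⟨fun e => this (e ▸ h), Or.inr h⟩
  have hsY : ∀ k ∈ Y, (V ∪ Y).erase k = V ∪ Y.erase k := by
    intro k hk
    have := Finset.disjoint_right.1 hVY hk
    ext x; simp only [Finset.mem_erase, Finset.mem_union]
    constructor
    · tauto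
    · rintro (h | h)
      · exact ⟨fun e => this (e ▸ h), Or.inl h⟩
      · tauto
  have g1 : ∀ (s : Finset ℂ) (t : ℂ), ∏ v ∈ s, gg c v t = (-c) ^ s.card * ∏ v ∈ s, (t - v)⁻¹ := by
    intro s t
    rw [← Finset.prod_const, ← Finset.prod_mul_distrib]
    refine Finset.prod_congr rfl fun v _ => ?_
    rw [gg, ← neg_sub t v, div_neg, neg_mul, div_eq_mul_inv]
  have h1 : ∀ (t : ℂ), ∏ v ∈ X, hh c t v = (c⁻¹) ^ X.card * ∏ v ∈ X, (t - v + c) := by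
    intro t
    rw [← Finset.prod_const, ← Finset.prod_mul_distrib]
    refine Finset.prod_congr rfl fun v _ => ?_
    rw [hh, div_eq_mul_inv, mul_comm]
  have f1 : ∀ (s : Finset ℂ) (t : ℂ), ∏ v ∈ s, ff c t v =
      (∏ v ∈ s, (t - v)⁻¹) * ∏ v ∈ s, (t - v + c) := by
    intro s t
    rw [← Finset.prod_mul_distrib]
    refine Finset.prod_congr rfl fun v _ => ?_
    rw [ff, div_eq_mul_inv, mul_comm]
  have nV : ∏ v ∈ V, (z - v) ≠ 0 := by
    rw [Finset.prod_ne_zero_iff]; intro v hv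
    exact sub_ne_zero.2 (by rintro rfl; exact hzV hv)
  have nY : ∏ v ∈ Y, (z - v) ≠ 0 := by
    rw [Finset.prod_ne_zero_iff]; intro v hv
    exact sub_ne_zero.2 (by rintro rfl; exact hzY hv)
  have tY : ∀ k ∈ Y, (∏ v ∈ V, gg c v k) * (∏ y ∈ Y.erase k, ff c k y) * (∏ x ∈ X, hh c k x) *
      gg c z k = ((-c) ^ (X.card + 1) * (c⁻¹) ^ X.card) *
      (Lagrange.nodalWeight (V ∪ Y) id k * (z - id k)⁻¹ * N.eval (id k)) := by
    intro k hk
    rw [g1, f1, h1, hNe, Lagrange.nodalWeight, hsY k hk,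
      Finset.prod_union (hVY.mono_right (Finset.erase_subset _ _)), hcard,
      ← Finset.mul_prod_erase Y (fun y => id k - y + c) hk]
    simp only [id, gg, div_eq_mul_inv]
    ring
  have tV : ∀ j ∈ V, gg c j z * (∏ x ∈ X, hh c j x) * (∏ y ∈ Y, ff c j y) *
          (∏ v ∈ V.erase j, gg c v j) = ((-c) ^ (X.card + 1) * (c⁻¹) ^ X.card) *
      (Lagrange.nodalWeight (V ∪ Y) id j * (z - id j)⁻¹ * N.eval (id j)) := by
    intro j hj
    have hcj : (V.erase j).card = X.card := by rw [Finset.card_erase_of_mem hj, hcard]; rfl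
    rw [g1, f1, h1, hNe, Lagrange.nodalWeight, hsV j hj,
      Finset.prod_union (hVY.mono_left (Finset.erase_subset _ _)), hcj]
    simp only [id, gg]
    rw [← neg_sub z j, div_neg, div_eq_mul_inv]
    ring
  rw [Finset.sum_congr rfl tY, Finset.sum_congr rfl tV, ← Finset.mul_sum, ← Finset.mul_sum,
    ← mul_add, add_comm (Finset.sum Y _), g1, f1, h1, hcard]
  rw [hNe] at key2
  simp only [id, Finset.prod_inv_distrib] at key2 ⊢
  generalize (∑ x ∈ V, Lagrange.nodalWeight (V ∪ Y) id x * (z - x)⁻¹ * Polynomial.eval x N) = S1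
    at key2 ⊢
  generalize (∑ x ∈ Y, Lagrange.nodalWeight (V ∪ Y) id x * (z - x)⁻¹ * Polynomial.eval x N) = S2
    at key2 ⊢
  field_simp
  rw [mul_assoc, key2]
  ring

theorem reindex {β : Type*} [AddCommMonoid β] (U : Finset ℂ) (φ : ℂ → Finset ℂ → β) :
    ∑ k ∈ U, ∑ s ∈ (U.erase k).powerset, φ k s = ∑ s ∈ U.powerset, ∑ k ∈ s, φ k (s.erase k) := by
  rw [Finset.sum_sigma', Finset.sum_sigma']
  refine Finset.sum_bij' (fun p _ => ⟨insert p.1 p.2, p.1⟩) (fun p _ => ⟨p.2, p.1.erase p.2⟩)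
    ?_ ?_ ?_ ?_ ?_
  · rintro ⟨k, s⟩ h
    simp only [Finset.mem_sigma, Finset.mem_powerset] at h ⊢
    exact ⟨Finset.insert_subset h.1 (h.2.trans (Finset.erase_subset _ _)), by simp⟩
  · rintro ⟨s, k⟩ h
    simp only [Finset.mem_sigma, Finset.mem_powerset] at h ⊢
    exact ⟨h.1 h.2, Finset.erase_subset_erase _ h.1⟩
  · rintro ⟨k, s⟩ h
    simp only [Finset.mem_sigma, Finset.mem_powerset] at h ⊢
    have : k ∉ s := fun hk => by simpa using h.2 hk
    simp [this]
  · rintro ⟨s, k⟩ h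
    simp only [Finset.mem_sigma, Finset.mem_powerset] at h ⊢
    simp [Finset.insert_erase h.2]
  · rintro ⟨k, s⟩ h
    simp only [Finset.mem_sigma, Finset.mem_powerset] at h ⊢
    have : k ∉ s := fun hk => by simpa using h.2 hk
    simp [this]

theorem reindex2 {β : Type*} [AddCommMonoid β] (U : Finset ℂ) (φ : ℂ → Finset ℂ → β) :
    ∑ s ∈ U.powerset, ∑ k ∈ s, φ k (s.erase k) = ∑ s ∈ U.powerset, ∑ k ∈ U \ s, φ k s := by
  rw [← reindex]
  refine Finset.sum_comm' ?_
  intro k s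
  simp only [Finset.mem_powerset, Finset.mem_sdiff, Finset.subset_erase]
  tauto

/-- the scalar coefficient of one term -/
def Kc (c : ℂ) (lam : ℂ → ℂ) (s t q r : Finset ℂ) : ℂ :=
  (∏ x ∈ q, ∏ y ∈ s, gg c x y) * (∏ x ∈ s, ∏ y ∈ t, ff c x y) *
    (∏ x ∈ r, ∏ y ∈ q, gg c x y) * Hne c s * ∏ x ∈ q, lam x

/-- the Bethe operator, in terms of finite sets -/
def PhiF (c : ℂ) (T : Fin 3 → Fin 3 → ℂ → A) (lam : ℂ → ℂ) (U V : Finset ℂ) : A :=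
  ∑ s ∈ U.powerset, ∑ q ∈ V.powerset,
    if s.card = q.card then
      Kc c lam s (U \ s) q (V \ q) •
        (DD c (T 0 2) s * BB (T 0 1) (U \ s) * DD c (T 1 2) (V \ q))
    else 0

theorem coef_identity {c : ℂ} (hc : c ≠ 0) (lam : ℂ → ℂ) (z : ℂ) (U V s q : Finset ℂ)
    (hs : s ⊆ U) (hq : q ⊆ V) (hUV : Disjoint U V) (hzU : z ∉ U) (hzV : z ∉ V)
    (hcard : s.card + 1 = q.card) :
    Kc c lam (insert z s) (U \ s) q (V \ q) =
      (∑ k ∈ U \ s, Kc c lam (insert k s) ((U \ s).erase k) q (V \ q) *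
        (gg c z k * (∏ y ∈ s, gg c y k) * ∏ y ∈ s, hh c y z)) +
      ∑ x ∈ q, (lam x * gg c x z * (∏ y ∈ U, ff c x y) * ∏ y ∈ V.erase x, gg c y x) *
        (Kc c lam s (U \ s) (q.erase x) (V \ q) * ∏ y ∈ s, hh c y z) := by
  have hzs : z ∉ s := fun h => hzU (hs h)
  have P := partial_frac hc z q s (U \ s)
    (Finset.disjoint_of_subset_left hq (hUV.symm.mono_right Finset.sdiff_subset))
    (fun h => hzV (hq h)) (fun h => hzU (Finset.mem_sdiff.1 h).1) hcard.symm
  set C := (∏ x ∈ q, ∏ y ∈ s, gg c x y) * (∏ x ∈ s, ∏ y ∈ U \ s, ff c x y) *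
    (∏ x ∈ V \ q, ∏ y ∈ q, gg c x y) * Hne c s * (∏ x ∈ q, lam x) * ∏ y ∈ s, hh c y z with hC
  have fgh : ∀ x y, ff c x y = gg c x y * hh c x y := by
    intro x y; simp only [ff, gg, hh]; field_simp
  have e0 : Kc c lam (insert z s) (U \ s) q (V \ q) =
      C * ((∏ v ∈ q, gg c v z) * (∏ y ∈ U \ s, ff c z y) * (∏ x ∈ s, hh c z x)) := by
    simp only [Kc, Hne_insert c hzs, Finset.prod_insert hzs, Finset.prod_mul_distrib, hC]
    ring
  rw [e0, P, mul_add, Finset.mul_sum, Finset.mul_sum]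
  congr 1
  · refine Finset.sum_congr rfl fun k hk => ?_
    have hks : k ∉ s := (Finset.mem_sdiff.1 hk).2
    have : ∏ x ∈ s, ∏ y ∈ U \ s, ff c x y = (∏ x ∈ s, gg c x k) * (∏ x ∈ s, hh c x k) *
        ∏ x ∈ s, ∏ y ∈ (U \ s).erase k, ff c x y := by
      rw [← Finset.prod_mul_distrib, ← Finset.prod_mul_distrib]
      refine Finset.prod_congr rfl fun x _ => ?_
      rw [← fgh, Finset.mul_prod_erase (U \ s) (fun y => ff c x y) hk]
    simp only [Kc, Hne_insert c hks, Finset.prod_insert hks, Finset.prod_mul_distrib, hC, this]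
    ring
  · refine Finset.sum_congr rfl fun x hx => ?_
    have a1 : ∏ v ∈ q, ∏ y ∈ s, gg c v y =
        (∏ y ∈ s, gg c x y) * ∏ v ∈ q.erase x, ∏ y ∈ s, gg c v y :=
      (Finset.mul_prod_erase q _ hx).symm
    have a2 : ∏ v ∈ V \ q, ∏ y ∈ q, gg c v y =
        (∏ v ∈ V \ q, gg c v x) * ∏ v ∈ V \ q, ∏ y ∈ q.erase x, gg c v y := by
      rw [← Finset.prod_mul_distrib]
      exact Finset.prod_congr rfl fun v _ => (Finset.mul_prod_erase q _ hx).symm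
    have a3 : ∏ v ∈ q, lam v = lam x * ∏ v ∈ q.erase x, lam v :=
      (Finset.mul_prod_erase q _ hx).symm
    have a4 : ∏ y ∈ U, ff c x y = (∏ y ∈ U \ s, ff c x y) *
        ((∏ y ∈ s, gg c x y) * ∏ y ∈ s, hh c x y) := by
      rw [← Finset.prod_sdiff hs, ← Finset.prod_mul_distrib (s := s)]
      simp only [← fgh]
    have a5 : ∏ y ∈ V.erase x, gg c y x = (∏ y ∈ V \ q, gg c y x) * ∏ y ∈ q.erase x, gg c y x := by
      rw [← Finset.prod_union]
      · congr 1
        ext y; simp only [Finset.mem_erase, Finset.mem_union, Finset.mem_sdiff]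
        constructor
        · tauto
        · rintro (h | h)
          · exact ⟨fun e => h.2 (e ▸ hx), h.1⟩
          · exact ⟨h.1, hq h.2⟩
      · exact Finset.sdiff_disjoint.mono_right (Finset.erase_subset _ _)
    simp only [Kc, hC, a1, a2, a3, a4, a5]
    ring

theorem PhiF_rec {c : ℂ} (hc : c ≠ 0) {T : Fin 3 → Fin 3 → ℂ → A} (hT : IsTFam c p21 T)
    (lam : ℂ → ℂ) (z : ℂ) (U V : Finset ℂ) (hUV : Disjoint U V) (hzU : z ∉ U) (hzV : z ∉ V)
    (hg : Good c (insert z U)) :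
    PhiF c T lam (insert z U) V = T 0 1 z * PhiF c T lam U V +
      ∑ x ∈ V, (lam x * gg c x z * (∏ y ∈ U, ff c x y) * ∏ y ∈ V.erase x, gg c y x) •
        (T 0 2 z * PhiF c T lam U (V.erase x)) := by
  have hS := rel_swap hc hT 0 rfl
  have hB := rel_comm hT
  set Op : Finset ℂ → Finset ℂ → A := fun s q =>
    DD c (T 0 2) (insert z s) * BB (T 0 1) (U \ s) * DD c (T 1 2) (V \ q) with hOp
  set Q : Finset ℂ → Finset ℂ → A := fun s q =>
    DD c (T 0 2) s * BB (T 0 1) (insert z (U \ s)) * DD c (T 1 2) (V \ q) with hQ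
  -- left side
  have L : PhiF c T lam (insert z U) V =
      (∑ s ∈ U.powerset, ∑ q ∈ V.powerset, if s.card = q.card then
        Kc c lam s (insert z (U \ s)) q (V \ q) • Q s q else 0) +
      ∑ s ∈ U.powerset, ∑ q ∈ V.powerset, if s.card + 1 = q.card then
        Kc c lam (insert z s) (U \ s) q (V \ q) • Op s q else 0 := by
    rw [PhiF, Finset.sum_powerset_insert hzU]
    congr 1 <;> refine Finset.sum_congr rfl fun s hs => Finset.sum_congr rfl fun q _ => ?_
    all_goals
      have hzs : z ∉ s := fun h => hzU (Finset.mem_powerset.1 hs h)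
    · rw [Finset.insert_sdiff_of_notMem _ hzs]
    · have : insert z U \ insert z s = U \ s := by
        rw [Finset.insert_sdiff_insert, Finset.sdiff_insert_of_notMem hzU]
      rw [Finset.card_insert_of_notMem hzs, this]
  have R1 : T 0 1 z * PhiF c T lam U V =
      (∑ s ∈ U.powerset, ∑ q ∈ V.powerset, if s.card = q.card then
        Kc c lam s (insert z (U \ s)) q (V \ q) • Q s q else 0) +
      ∑ s ∈ U.powerset, ∑ k ∈ U \ s, ∑ q ∈ V.powerset, if s.card + 1 = q.card then
        (Kc c lam (insert k s) ((U \ s).erase k) q (V \ q) *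
        (gg c z k * (∏ y ∈ s, gg c y k) * ∏ y ∈ s, hh c y z)) • Op s q else 0 := by
    rw [← reindex2 U (fun k s => ∑ q ∈ V.powerset, if s.card + 1 = q.card then
        (Kc c lam (insert k s) ((U \ s).erase k) q (V \ q) *
        (gg c z k * (∏ y ∈ s, gg c y k) * ∏ y ∈ s, hh c y z)) • Op s q else 0),
      ← Finset.sum_add_distrib, PhiF, Finset.mul_sum]
    refine Finset.sum_congr rfl fun s hs => ?_
    rw [Finset.sum_comm, ← Finset.sum_add_distrib, Finset.mul_sum]
    refine Finset.sum_congr rfl fun q _ => ?_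
    have hs := Finset.mem_powerset.1 hs
    have hzs : z ∉ s := fun h => hzU (hs h)
    have cc : ∀ k ∈ s, (s.erase k).card + 1 = s.card := fun k hk =>
      Finset.card_erase_add_one hk
    by_cases hcq : s.card = q.card
    · rw [if_pos hcq, if_pos hcq, mul_smul_comm, ← mul_assoc, ← mul_assoc,
        op_lemma hc hT s z hzs (hg.mono (Finset.insert_subset_insert _ hs)), add_mul, add_mul,
        smul_add]
      congr 1
      · rw [smul_mul_assoc, mul_assoc (DD c (T 0 2) s), BB_insert hB (fun h => hzU (Finset.mem_sdiff.1 h).1)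
          (hg.mono (Finset.insert_subset_insert _ Finset.sdiff_subset)), smul_mul_assoc, smul_smul]
        congr 1
        have : z ∉ U \ s := fun h => hzU (Finset.mem_sdiff.1 h).1
        simp only [Kc, Finset.prod_insert this, Finset.prod_mul_distrib]
        ring
      · rw [Finset.sum_mul, Finset.sum_mul, Finset.smul_sum]
        refine Finset.sum_congr rfl fun k hk => ?_
        rw [if_pos ((cc k hk).trans hcq)]
        have hks : k ∉ U \ s := fun h => (Finset.mem_sdiff.1 h).2 hk
        have e1 : U \ s.erase k = insert k (U \ s) := Finset.sdiff_erase (hs hk)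
        rw [smul_mul_assoc, mul_assoc (DD c (T 0 2) (insert z (s.erase k))), BB_insert hB hks (hg.mono (by
            intro y hy
            rcases Finset.mem_insert.1 hy with rfl | hy
            · exact Finset.mem_insert_of_mem (hs hk)
            · exact Finset.mem_insert_of_mem (Finset.mem_sdiff.1 hy).1)), smul_mul_assoc,
          smul_smul, hOp]
        simp only
        rw [e1, Finset.erase_insert hks, Finset.insert_erase hk]
    · rw [if_neg hcq, if_neg hcq, mul_zero, zero_add]
      symm
      refine Finset.sum_eq_zero fun k hk => if_neg ?_
      rw [cc k hk]; exact hcq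
  have R2 : (∑ x ∈ V, (lam x * gg c x z * (∏ y ∈ U, ff c x y) * ∏ y ∈ V.erase x, gg c y x) •
        (T 0 2 z * PhiF c T lam U (V.erase x))) =
      ∑ s ∈ U.powerset, ∑ q ∈ V.powerset, ∑ x ∈ q, if s.card + 1 = q.card then
        ((lam x * gg c x z * (∏ y ∈ U, ff c x y) * ∏ y ∈ V.erase x, gg c y x) *
        (Kc c lam s (U \ s) (q.erase x) (V \ q) * ∏ y ∈ s, hh c y z)) • Op s q else 0 := by
    have : ∀ s ∈ U.powerset, (∑ q ∈ V.powerset, ∑ x ∈ q, if s.card + 1 = q.card then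
        ((lam x * gg c x z * (∏ y ∈ U, ff c x y) * ∏ y ∈ V.erase x, gg c y x) *
        (Kc c lam s (U \ s) (q.erase x) (V \ q) * ∏ y ∈ s, hh c y z)) • Op s q else 0) =
        ∑ x ∈ V, ∑ q ∈ (V.erase x).powerset,
          (lam x * gg c x z * (∏ y ∈ U, ff c x y) * ∏ y ∈ V.erase x, gg c y x) •
          (T 0 2 z * if s.card = q.card then Kc c lam s (U \ s) q (V.erase x \ q) •
          (DD c (T 0 2) s * BB (T 0 1) (U \ s) * DD c (T 1 2) (V.erase x \ q)) else 0) := by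
      intro s hs
      have hs := Finset.mem_powerset.1 hs
      have hzs : z ∉ s := fun h => hzU (hs h)
      rw [reindex V (fun x q =>
          (lam x * gg c x z * (∏ y ∈ U, ff c x y) * ∏ y ∈ V.erase x, gg c y x) •
          (T 0 2 z * if s.card = q.card then Kc c lam s (U \ s) q (V.erase x \ q) •
          (DD c (T 0 2) s * BB (T 0 1) (U \ s) * DD c (T 1 2) (V.erase x \ q)) else 0))]
      refine Finset.sum_congr rfl fun q hq => Finset.sum_congr rfl fun x hx => ?_
      have e1 : V.erase x \ q.erase x = V \ q := by
        ext y; simp only [Finset.mem_sdiff, Finset.mem_erase]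
        constructor
        · tauto
        · rintro ⟨h1, h2⟩
          have : y ≠ x := by rintro rfl; exact h2 hx
          tauto
      have e2 := Finset.card_erase_add_one hx
      rw [e1]
      by_cases hcq : s.card + 1 = q.card
      · have : s.card = (q.erase x).card := by omega
        rw [if_pos hcq, if_pos this, mul_smul_comm, ← mul_assoc (T 0 2 z), ← mul_assoc (T 0 2 z),
          DD_insert hc hS hzs (hg.mono (Finset.insert_subset_insert _ hs)), smul_mul_assoc,
          smul_mul_assoc, smul_smul, smul_smul, ← mul_assoc (_ * _ * _ * _) (Kc _ _ _ _ _ _)]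
      · have : ¬ s.card = (q.erase x).card := by omega
        rw [if_neg hcq, if_neg this, mul_zero, smul_zero]
    rw [Finset.sum_congr rfl this, Finset.sum_comm]
    refine Finset.sum_congr rfl fun x _ => ?_
    rw [PhiF]
    simp only [Finset.mul_sum, Finset.smul_sum]
  rw [L, R1, R2, add_assoc]
  congr 1
  rw [← Finset.sum_add_distrib]
  refine Finset.sum_congr rfl fun s hs => ?_
  rw [Finset.sum_comm, ← Finset.sum_add_distrib]
  refine Finset.sum_congr rfl fun q hq => ?_
  by_cases hcq : s.card + 1 = q.card
  · simp only [if_pos hcq]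
    rw [← Finset.sum_smul, ← Finset.sum_smul, ← add_smul,
      coef_identity hc lam z U V s q (Finset.mem_powerset.1 hs) (Finset.mem_powerset.1 hq) hUV
        hzU hzV hcq]
  · simp [if_neg hcq]

theorem sel_perm {l : List ℂ} (hl : l.Nodup) (S : Finset (Fin l.length)) :
    (sel l S).Perm (S.image l.get).toList := by
  have hinj : Function.Injective l.get := List.nodup_iff_injective_get.1 hl
  rw [List.perm_ext_iff_of_nodup _ (Finset.nodup_toList _)]
  · intro x; simp [sel]
  · exact (Finset.sort_nodup _ _).map hinj

theorem prod2_perm (φ : ℂ → ℂ → ℂ) {l l' : List ℂ} {s t : Finset ℂ} (h : l.Perm s.toList)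
    (h' : l'.Perm t.toList) :
    (l.map fun x => (l'.map fun y => φ x y).prod).prod = ∏ x ∈ s, ∏ y ∈ t, φ x y := by
  rw [(h.map _).prod_eq, Finset.prod_map_toList]
  refine Finset.prod_congr rfl fun x _ => ?_
  rw [(h'.map _).prod_eq, Finset.prod_map_toList]

theorem prodHHne_eq (c : ℂ) {l : List ℂ} (hl : l.Nodup) : prodHHne c l = Hne c l.toFinset := by
  have hinj : Function.Injective l.get := List.nodup_iff_injective_get.1 hl
  have him : l.toFinset = Finset.univ.image l.get := by
    ext x; simp [List.mem_iff_get]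
  rw [prodHHne, Hne, him, Finset.prod_image (fun _ _ _ _ h => hinj h)]
  refine Finset.prod_congr rfl fun j _ => ?_
  rw [← Finset.image_erase hinj, Finset.prod_image (fun _ _ _ _ h => hinj h),
    ← Finset.filter_ne Finset.univ j, Finset.prod_filter]

theorem PhiA_eq {c : ℂ} (hc : c ≠ 0) {T : Fin 3 → Fin 3 → ℂ → A} (hT : IsTFam c p21 T)
    (lam : ℂ → ℂ) (u v : List ℂ) (hu : Admissible c u) (hv : Admissible c v) :
    PhiA c T lam u v = PhiF c T lam u.toFinset v.toFinset := by
  have nu : u.Nodup := hu.imp fun h => h.1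
  have nv : v.Nodup := hv.imp fun h => h.1
  have gu := hu.good
  have gv := hv.good
  have inj : ∀ {l : List ℂ}, l.Nodup → Function.Injective l.get :=
    fun h => List.nodup_iff_injective_get.1 h
  have him : ∀ l : List ℂ, l.toFinset = Finset.univ.image l.get := by
    intro l; ext x; simp [List.mem_iff_get]
  have hcompl : ∀ {l : List ℂ}, l.Nodup → ∀ S : Finset (Fin l.length),
      Sᶜ.image l.get = l.toFinset \ S.image l.get := by
    intro l hl S
    rw [him, Finset.compl_eq_univ_sdiff, Finset.image_sdiff _ _ (inj hl)]
  have hsub : ∀ (l : List ℂ) (S : Finset (Fin l.length)), S.image l.get ⊆ l.toFinset := by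
    intro l S; rw [him]; exact Finset.image_subset_image (Finset.subset_univ _)
  have hsum : ∀ (l : List ℂ), l.Nodup → ∀ F : Finset ℂ → A,
      ∑ s ∈ l.toFinset.powerset, F s = ∑ S : Finset (Fin l.length), F (S.image l.get) := by
    intro l hl F
    symm
    refine Finset.sum_bij (fun S _ => S.image l.get) ?_ ?_ ?_ ?_
    · intro S _; exact Finset.mem_powerset.2 (hsub l S)
    · intro S _ S' _ h; exact Finset.image_injective (inj hl) h
    · intro s hs
      rw [Finset.mem_powerset, him] at hs
      obtain ⟨S, _, hS⟩ := Finset.subset_image_iff.1 hs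
      exact ⟨S, Finset.mem_univ _, hS⟩
    · intro S _; rfl
  rw [PhiF, hsum u nu, PhiA]
  refine Finset.sum_congr rfl fun S _ => ?_
  rw [hsum v nv]
  refine Finset.sum_congr rfl fun R _ => ?_
  rw [Finset.card_image_of_injective _ (inj nu), Finset.card_image_of_injective _ (inj nv),
    ← hcompl nu, ← hcompl nv]
  have pad : ∀ {s : Finset ℂ} {l : List ℂ}, Good c s → l.Perm s.toList → Admissible c l :=
    fun hs hp => hs.admissible.perm hp.symm
  have p1 := sel_perm nu S
  have p2 := sel_perm nu Sᶜ
  have p3 := sel_perm nv R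
  have p4 := sel_perm nv Rᶜ
  have nS : (sel u S).Nodup := p1.symm.nodup (Finset.nodup_toList _)
  have fS : (sel u S).toFinset = S.image u.get := by
    rw [List.toFinset_eq_of_perm _ _ p1, Finset.toList_toFinset]
  congr 2
  · rw [prodGG, prodGG, prodFF, prod2_perm _ p3 p1, prod2_perm _ p1 p2, prod2_perm _ p4 p3,
      prodHHne_eq c nS, fS, lamP, (p3.map _).prod_eq, Finset.prod_map_toList, Kc]
  · rw [DD, DD, BB, TT_perm hc (rel_swap hc hT 0 rfl) p1 (pad (gu.mono (hsub _ _)) p1),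
      TT_perm hc (rel_swap hc hT 1 rfl) p4 (pad (gv.mono (hsub _ _)) p4),
      Tprod_perm (rel_comm hT) p2 (pad (gu.mono (hsub _ _)) p2)]

/-- first recursion for the `Y(2|1)` Bethe vector. -/
theorem statement6 {M : Type*} [AddCommGroup M] [Module ℂ M] [Module A M]
    [IsScalarTower ℂ A M]
    (c : ℂ) (hc : c ≠ 0) (T : Fin 3 → Fin 3 → ℂ → A)
    (hT : IsTFam c p21 T) (lam : Fin 3 → ℂ → ℂ) (Ω : M)
    (hw0 : ∀ i j : Fin 3, j < i → ∀ z : ℂ, T i j z • Ω = 0)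
    (hw1 : ∀ i : Fin 3, ∀ z : ℂ, T i i z • Ω = lam i z • Ω)
    (u1 : ℂ) (u' v : List ℂ) (hadm : Admissible c ((u1 :: u') ++ v)) :
    PhiA c T (lam 1) (u1 :: u') v • Ω
      = T 0 1 u1 • (PhiA c T (lam 1) u' v • Ω)
        + ∑ j : Fin v.length,
            (lam 1 (v.get j) * gg c (v.get j) u1 * prodFF c [v.get j] u' *
                prodGG c (v.eraseIdx (j : ℕ)) [v.get j]) •
              (T 0 2 u1 • (PhiA c T (lam 1) u' (v.eraseIdx (j : ℕ)) • Ω)) := by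
  have hU : Admissible c (u1 :: u') := (List.pairwise_append.1 hadm).1
  have hV : Admissible c v := (List.pairwise_append.1 hadm).2.1
  have hUV := (List.pairwise_append.1 hadm).2.2
  have hu' : Admissible c u' := (List.pairwise_cons.1 hU).2
  have nv : v.Nodup := hV.imp fun h => h.1
  have nu' : u'.Nodup := hu'.imp fun h => h.1
  have hinj : Function.Injective v.get := List.nodup_iff_injective_get.1 nv
  have hve : ∀ j : Fin v.length, Admissible c (v.eraseIdx (j : ℕ)) := fun j =>
    List.Pairwise.sublist (List.eraseIdx_sublist _ _) hV
  have hef : ∀ j : Fin v.length, (v.eraseIdx (j : ℕ)).toFinset = v.toFinset.erase (v.get j) := by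
    intro j
    rw [← List.Nodup.erase_get nv]
    ext x
    rw [List.mem_toFinset, nv.mem_erase_iff, Finset.mem_erase, List.mem_toFinset]
  have him : v.toFinset = Finset.univ.image v.get := by
    ext x; simp [List.mem_iff_get]
  have hlist : ∀ (l : List ℂ) (φ : ℂ → ℂ), l.Nodup → (l.map φ).prod = ∏ x ∈ l.toFinset, φ x :=
    fun l φ hl => (List.prod_toFinset φ hl).symm
  have main := PhiF_rec hc hT (lam 1) u1 u'.toFinset v.toFinset
    (by
      rw [Finset.disjoint_left]
      intro x hx hx'
      exact (hUV x (by simp [List.mem_toFinset.1 hx]) x (List.mem_toFinset.1 hx')).1 rfl)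
    (by
      intro h
      exact ((List.pairwise_cons.1 hU).1 u1 (List.mem_toFinset.1 h)).1 rfl)
    (by
      intro h
      exact (hUV u1 (by simp) u1 (List.mem_toFinset.1 h)).1 rfl)
    (by rw [← List.toFinset_cons]; exact hU.good)
  have hsum : ∀ F : ℂ → A, ∑ x ∈ v.toFinset, F x = ∑ j : Fin v.length, F (v.get j) := by
    intro F
    rw [him, Finset.sum_image (fun _ _ _ _ h => hinj h)]
  rw [hsum] at main
  rw [PhiA_eq hc hT _ _ _ hU hV, PhiA_eq hc hT _ _ _ hu' hV, List.toFinset_cons, main, add_smul,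
    Finset.sum_smul, mul_smul]
  congr 1
  refine Finset.sum_congr rfl fun j _ => ?_
  have e1 : prodFF c [v.get j] u' = ∏ y ∈ u'.toFinset, ff c (v.get j) y := by
    simp only [prodFF, List.map_cons, List.map_nil, List.prod_cons, List.prod_nil, mul_one]
    exact hlist _ _ nu'
  have e2 : prodGG c (v.eraseIdx (j : ℕ)) [v.get j] =
      ∏ y ∈ v.toFinset.erase (v.get j), gg c y (v.get j) := by
    simp only [prodGG, List.map_cons, List.map_nil, List.prod_cons, List.prod_nil, mul_one]
    rw [hlist _ _ ((hve j).imp fun h => h.1), hef]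
  rw [PhiA_eq hc hT _ _ _ hu' (hve j), hef, e1, e2, smul_assoc, mul_smul (T 0 2 u1)]

end Bethe
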